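/- A nonzero R-module M is dual Baer if and only if the trace Tr(M,N) = Σ{f(M) : f ∈ Hom_R(M,N)} is a direct summand of M for every submodule N ≤ M. -/

import Mathlib

universe u v

/-- `M` is a dual Baer module: for every submodule `N` of `M`, the right ideal
`Hom(M,N)` of `End(M)` is generated by an idempotent. -/
def IsDualBaerModule (R : Type u) [Ring R] (M : Type v) [AddCommGroup M]
    [Module R M] : Prop :=
  ∀ N : Submodule R M, ∃ e : Module.End R M, IsIdempotentElem e ∧
    {f : Module.End R M | LinearMap.range f ≤ N} = Set.range fun s => e * s

/-- The trace of `M` in a submodule `N`: the sum of images of all endomorphisms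
of `M` whose range is contained in `N`. -/
def traceIn (R : Type u) [Ring R] (M : Type v) [AddCommGroup M] [Module R M]
    (N : Submodule R M) : Submodule R M :=
  ⨆ f ∈ {f : Module.End R M | LinearMap.range f ≤ N}, LinearMap.range f

theorem traceIn_le (R : Type u) [Ring R] (M : Type v) [AddCommGroup M] [Module R M]
    (N : Submodule R M) : traceIn R M N ≤ N :=
  iSup₂_le fun _ hf => hf

theorem range_le_traceIn {R : Type u} [Ring R] {M : Type v} [AddCommGroup M] [Module R M]
    {N : Submodule R M} {f : Module.End R M} (hf : LinearMap.range f ≤ N) :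
    LinearMap.range f ≤ traceIn R M N :=
  le_iSup₂_of_le f hf le_rfl

theorem traceIn_eq_range {R : Type u} [Ring R] {M : Type v} [AddCommGroup M] [Module R M]
    {N : Submodule R M} {e : Module.End R M}
    (he : {f : Module.End R M | LinearMap.range f ≤ N} = Set.range fun s => e * s) :
    traceIn R M N = LinearMap.range e := by
  apply le_antisymm
  · refine iSup₂_le fun f hf => ?_
    rw [he] at hf
    obtain ⟨s, rfl⟩ := hf
    exact LinearMap.range_comp_le_range s e
  · have h : e ∈ {f : Module.End R M | LinearMap.range f ≤ N} := by
      rw [he]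
      exact ⟨1, mul_one e⟩
    exact range_le_traceIn h

theorem stmt14 (R : Type u) [Ring R] (M : Type v) [AddCommGroup M] [Module R M]
    [Nontrivial M] :
    IsDualBaerModule R M ↔
      ∀ N : Submodule R M, ∃ p : Submodule R M, IsCompl (traceIn R M N) p := by
  refine forall_congr' fun N => ⟨?_, ?_⟩
  · rintro ⟨e, he, h⟩
    rw [traceIn_eq_range h]
    exact ⟨_, LinearMap.IsIdempotentElem.isCompl he⟩
  · rintro ⟨p, hp⟩
    refine ⟨(traceIn R M N).projection p hp, Submodule.isIdempotentElem_projection hp, Set.ext fun f => ⟨fun hf => ?_, ?_⟩⟩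
    · refine ⟨f, LinearMap.ext fun x => ?_⟩
      exact Submodule.projection_apply_left hp ⟨f x, range_le_traceIn hf ⟨x, rfl⟩⟩
    · rintro ⟨s, rfl⟩
      refine (LinearMap.range_comp_le_range s ((traceIn R M N).projection p hp)).trans ?_
      rw [Submodule.range_projection]
      exact traceIn_le R M N
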